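/- arXiv:1009.2373 — 3 statements merged into one kernel-verified Lean document; each statement's English description precedes it below -/
import Mathlib

section
/- Let p, q, r, u, γ be complex numbers with γ ≠ 0, γ² = u, and u³ + 2p·u² + (p² - 4r)·u - q² = 0. Then for every complex y, y⁴ + p·y² + q·y + r = (y² + γ·y + (p + u)/2 - q/(2γ))·(y² - γ·y + (p + u)/2 + q/(2γ)). (Descartes' factorization of the reduced quartic.) -/
theorem descartes_factorization (p q r u γ : ℂ) (hγ : γ ≠ 0) (hγu : γ ^ 2 = u)
    (hu : u ^ 3 + 2 * p * u ^ 2 + (p ^ 2 - 4 * r) * u - q ^ 2 = 0) :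
    ∀ y : ℂ,
      y ^ 4 + p * y ^ 2 + q * y + r =
        (y ^ 2 + γ * y + (p + u) / 2 - q / (2 * γ)) *
          (y ^ 2 - γ * y + (p + u) / 2 + q / (2 * γ)) := by
  intro y
  subst hγu
  obtain ⟨t, rfl⟩ : ∃ t, q = 2 * γ * t := ⟨q / (2 * γ), by field_simp⟩
  rw [mul_div_cancel_left₀ t (mul_ne_zero two_ne_zero hγ)]
  apply mul_left_cancel₀ (pow_ne_zero 2 hγ)
  linear_combination (-1 / 4) * hu
end

section
/- Let b, c, d be real numbers, set p = c - b²/3 and q = d - bc/3 + 2b³/27, and suppose the discriminant Δ = -4p³ - 27q² is positive (equivalently, p < 0 and (p/3)³ + (q/2)² < 0). Let φ = arccos((-q/2)/(-p/3)^{3/2}). Then the three real numbers x₁ = -b/3 + 2·√(-p/3)·cos(φ/3), x₂ = -b/3 - √(-p/3)·(cos(φ/3) + √3·sin(φ/3)) and x₃ = -b/3 - √(-p/3)·(cos(φ/3) - √3·sin(φ/3)) are exactly the three roots of f(x) = x³ + b·x² + c·x + d, i.e. (x - x₁)·(x - x₂)·(x - x₃) = x³ + b·x² + c·x + d for all real x.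 (Trigonometric solution of the casus irreducibilis.) -/
open Real

/-- With `r = √(-p/3)`, the reduced cubic `y³ + p y + q` with positive discriminant satisfies
`2 r³ cos φ = -q` for the angle `φ` of the casus irreducibilis. -/
theorem two_mul_sqrt_cube_mul_cos_arccos {p q : ℝ} (hΔ : -4 * p ^ 3 - 27 * q ^ 2 > 0)
    (hp : p < 0) :
    2 * Real.sqrt (-p / 3) ^ 3 *
      Real.cos (Real.arccos ((-q / 2) / (-p / 3) ^ ((3 : ℝ) / 2))) = -q := by
  have hpos : 0 < -p / 3 := by linarith
  have hpow : (-p / 3) ^ ((3 : ℝ) / 2) = Real.sqrt (-p / 3) ^ 3 := by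
    rw [Real.sqrt_eq_rpow, ← Real.rpow_natCast, ← Real.rpow_mul hpos.le]
    norm_num
  rw [hpow]
  have hr : 0 < Real.sqrt (-p / 3) ^ 3 := pow_pos (Real.sqrt_pos.mpr hpos) 3
  have hsq : (Real.sqrt (-p / 3) ^ 3) ^ 2 = (-p / 3) ^ 3 := by
    rw [pow_right_comm, Real.sq_sqrt hpos.le]
  have habs : |-q / 2| ≤ Real.sqrt (-p / 3) ^ 3 :=
    abs_le_of_sq_le_sq (by rw [hsq]; linarith) hr.le
  obtain ⟨hlo, hhi⟩ := abs_le.mp habs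
  rw [Real.cos_arccos (by rw [le_div_iff₀ hr]; linarith) (by rw [div_le_one hr]; exact hhi)]
  rw [mul_assoc, mul_div_cancel₀ _ hr.ne']
  ring

theorem trigonometric_solution_casus_irreducibilis (b c d p q : ℝ)
    (hp : p = c - b ^ 2 / 3) (hq : q = d - b * c / 3 + 2 * b ^ 3 / 27)
    (hΔ : -4 * p ^ 3 - 27 * q ^ 2 > 0)
    (φ : ℝ) (hφ : φ = Real.arccos ((-q / 2) / (-p / 3) ^ ((3 : ℝ) / 2)))
    (x₁ x₂ x₃ : ℝ)
    (hx₁ : x₁ = -b / 3 + 2 * Real.sqrt (-p / 3) * Real.cos (φ / 3))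
    (hx₂ : x₂ = -b / 3 - Real.sqrt (-p / 3) * (Real.cos (φ / 3) + Real.sqrt 3 * Real.sin (φ / 3)))
    (hx₃ : x₃ = -b / 3 - Real.sqrt (-p / 3) * (Real.cos (φ / 3) - Real.sqrt 3 * Real.sin (φ / 3))) :
    ∀ x : ℝ, (x - x₁) * (x - x₂) * (x - x₃) = x ^ 3 + b * x ^ 2 + c * x + d := by
  have hneg : p < 0 := by
    by_contra! h
    linarith [pow_nonneg h 3, sq_nonneg q]
  have hr : Real.sqrt (-p / 3) ^ 2 = -p / 3 := Real.sq_sqrt (by linarith)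
  have hcos := two_mul_sqrt_cube_mul_cos_arccos hΔ hneg
  rw [← hφ, show φ = 3 * (φ / 3) by ring, Real.cos_three_mul] at hcos
  have h3 : Real.sqrt 3 ^ 2 = 3 := Real.sq_sqrt (by norm_num)
  have hcs := Real.sin_sq_add_cos_sq (φ / 3)
  intro x
  subst hx₁ hx₂ hx₃
  have hpair : (Real.cos (φ / 3) + Real.sqrt 3 * Real.sin (φ / 3)) *
      (Real.cos (φ / 3) - Real.sqrt 3 * Real.sin (φ / 3)) = 4 * Real.cos (φ / 3) ^ 2 - 3 := by
    linear_combination -Real.sin (φ / 3) ^ 2 * h3 - 3 * hcs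
  linear_combination Real.sqrt (-p / 3) ^ 2 *
    (x + b / 3 - 2 * Real.sqrt (-p / 3) * Real.cos (φ / 3)) * hpair -
    3 * (x + b / 3) * hr - hcos + (x + b / 3) * hp + hq
end

section
/- Let b, c, d be real numbers, set p = c - b²/3 and q = d - bc/3 + 2b³/27, and suppose p > 0. Then x₀ = -b/3 - 2·√(p/3)·sinh((1/3)·arsinh((q/2)/(p/3)^{3/2})) is a real root of f(x) = x³ + b·x² + c·x + d, i.e. f(x₀) = 0. (Hyperbolic solution of the real cubic with one real root, case p > 0.) -/
theorem hyperbolic_solution_cubic_p_pos (b c d p q : ℝ)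
    (hp : p = c - b ^ 2 / 3) (hq : q = d - b * c / 3 + 2 * b ^ 3 / 27)
    (hppos : p > 0)
    (x₀ : ℝ)
    (hx₀ : x₀ = -b / 3 - 2 * Real.sqrt (p / 3) *
        Real.sinh ((1 / 3) * Real.arsinh ((q / 2) / (p / 3) ^ ((3 : ℝ) / 2)))) :
    x₀ ^ 3 + b * x₀ ^ 2 + c * x₀ + d = 0 := by
  have hpow : (p / 3) ^ ((3 : ℝ) / 2) = √(p / 3) ^ 3 := by
    rw [Real.rpow_div_two_eq_sqrt _ (by positivity)]
    exact_mod_cast Real.rpow_natCast (√(p / 3)) 3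
  rw [hpow] at hx₀
  have hr : 0 < √(p / 3) := by positivity
  have hr2 : √(p / 3) ^ 2 = p / 3 := Real.sq_sqrt (by positivity)
  have hs := Real.sinh_three_mul (1 / 3 * Real.arsinh (q / 2 / √(p / 3) ^ 3))
  rw [← mul_assoc, mul_one_div_cancel three_ne_zero, one_mul, Real.sinh_arsinh,
    div_eq_iff (by positivity)] at hs
  generalize √(p / 3) = r at *
  generalize Real.sinh (1 / 3 * Real.arsinh (q / 2 / r ^ 3)) = s at *
  obtain rfl : c = 3 * r ^ 2 + b ^ 2 / 3 := by linarith
  obtain rfl : d = q + b * (3 * r ^ 2 + b ^ 2 / 3) / 3 - 2 * b ^ 3 / 27 := by linarith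
  subst hx₀
  linear_combination 2 * hs
end
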